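/- arXiv:2106.11244 — 2 statements merged into one kernel-verified Lean document; each statement's English description precedes it below -/
import Mathlib

section
/- If r,k ∈ {3,…,n-1} with r ≤ k, then (k-1)(k-2) · |Λ_n(r,k)| = 2n(n-2)! · (r-2)(r-3); that is, |Λ_n(r,k)| = 2n(n-2)! (r-2)(r-3) / ((k-1)(k-2)). -/
open Finset

namespace Secretary

/-- Relative rank of `x` with regard to `P`: the number of `z ∈ P` with `z ≤ x`
(as an integer, so that differences can be computed in `ℤ`). -/
def rr {n : ℕ} (P : Finset (Fin n)) (x : Fin n) : ℤ :=
  ((P.filter fun z => z ≤ x).card : ℤ)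

/-- `Δ(k) = {-1, 1, k-1, 1-k} ⊆ ℤ`. -/
def Δ (k : ℕ) : Finset ℤ := {-1, 1, (k : ℤ) - 1, 1 - (k : ℤ)}

/-- `{x, y} ∈ Adj(P)`: both belong to `P` and the difference of their relative
ranks with regard to `P` (in one of the two orders) lies in `Δ(|P|)`. -/
def Adj {n : ℕ} (P : Finset (Fin n)) (x y : Fin n) : Prop :=
  x ∈ P ∧ y ∈ P ∧ (rr P x - rr P y ∈ Δ P.card ∨ rr P y - rr P x ∈ Δ P.card)

instance {n : ℕ} (P : Finset (Fin n)) (x y : Fin n) : Decidable (Adj P x y) := by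
  unfold Adj; infer_instance

/-- `Ω n`: the sequences of `n` distinct applicants (as injective, hence
bijective, functions `Fin n → Fin n`); `|Ω n| = n!`. -/
def Ω (n : ℕ) : Finset (Fin n → Fin n) :=
  Finset.univ.filter Function.Injective

/-- The `i`-th applicant of the sequence `x`, with the 1-based indexing
`x_1, …, x_n` of the paper. -/
def get {n : ℕ} [NeZero n] (x : Fin n → Fin n) (i : ℕ) : Fin n :=
  x ⟨(i - 1) % n, Nat.mod_lt _ (Nat.pos_of_ne_zero (NeZero.ne n))⟩

/-- The set `{x_1, …, x_i}` of the first `i` applicants of the sequence `x`. -/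
def pre {n : ℕ} (x : Fin n → Fin n) (i : ℕ) : Finset (Fin n) :=
  (Finset.univ.filter fun j : Fin n => (j : ℕ) < i).image x

/-- `Λ_n(r,k)`: sequences `x ∈ Ω_n` with `{x_k, x_{k+1}} ∈ Adj(C_n)` and
`{x_{i-1}, x_i} ∉ Adj({x_1,…,x_i})` for all `i ∈ {r,…,k}`. -/
def Lam : (n : ℕ) → ℕ → ℕ → Finset (Fin n → Fin n)
  | 0, _, _ => ∅
  | (m + 1), r, k =>
      (Ω (m + 1)).filter fun x =>
        Adj Finset.univ (get x k) (get x (k + 1)) ∧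
          ∀ i, i ≤ k → r ≤ i → ¬ Adj (pre x i) (get x (i - 1)) (get x i)

/-- `Λ_n(r) = ⋃_{k=r}^{n-1} Λ_n(r,k)`. -/
def LamU (n : ℕ) (r : ℕ) : Finset (Fin n → Fin n) :=
  (Finset.Icc r (n - 1)).biUnion fun k => Lam n r k

/-- `Π_n(r)`: those `x ∈ Λ_n(r)` such that for the (unique) `k` with
`x ∈ Λ_n(r,k)` one has `rr_n(x_k) - rr_n(x_{k+1}) ∈ {1-n, n-1}`. -/
def Pi' : (n : ℕ) → ℕ → Finset (Fin n → Fin n)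
  | 0, _ => ∅
  | (m + 1), r =>
      (LamU (m + 1) r).filter fun x =>
        ∃ k ∈ Finset.Icc r m, x ∈ Lam (m + 1) r k ∧
          rr Finset.univ (get x k) - rr Finset.univ (get x (k + 1)) ∈
            ({1 - ((m : ℤ) + 1), ((m : ℤ) + 1) - 1} : Finset ℤ)

/-- `Λ_n(r,k,z,z̄)`: sequences of `Λ_n(r,k)` with `x_k = z` and `x_{k+1} = z̄`. -/
def Lam4 : (n : ℕ) → ℕ → ℕ → Fin n → Fin n → Finset (Fin n → Fin n)
  | 0, _, _, z, _ => z.elim0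
  | (m + 1), r, k, z, w =>
      (Lam (m + 1) r k).filter fun x => get x k = z ∧ get x (k + 1) = w

lemma rr_lt_rr {n : ℕ} {P : Finset (Fin n)} {x y : Fin n} (hy : y ∈ P) (h : x < y) :
    rr P x < rr P y := by
  unfold rr
  norm_cast
  apply Finset.card_lt_card
  rw [Finset.ssubset_iff_of_subset]
  · exact ⟨y, by simp [hy], by simp [h]⟩
  · intro z
    simp only [Finset.mem_filter]
    exact fun hz => ⟨hz.1, hz.2.trans h.le⟩

lemma rr_injOn {n : ℕ} (P : Finset (Fin n)) : Set.InjOn (rr P) P := by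
  intro x hx y hy h
  rcases lt_trichotomy x y with hxy | hxy | hxy
  · exact absurd h (rr_lt_rr hy hxy).ne
  · exact hxy
  · exact absurd h (rr_lt_rr hx hxy).ne'

lemma image_rr {n : ℕ} (P : Finset (Fin n)) : P.image (rr P) = Finset.Icc 1 (P.card : ℤ) := by
  apply Finset.eq_of_subset_of_card_le
  · intro t ht
    obtain ⟨x, hx, rfl⟩ := Finset.mem_image.1 ht
    rw [Finset.mem_Icc]
    unfold rr
    constructor
    · exact_mod_cast Finset.card_pos.2 ⟨x, by simp [hx]⟩
    · exact_mod_cast Finset.card_filter_le _ _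
  · rw [Finset.card_image_of_injOn (rr_injOn P)]
    simp

lemma adj_comm {n : ℕ} {P : Finset (Fin n)} {x y : Fin n} : Adj P x y ↔ Adj P y x := by
  unfold Adj
  tauto

/-- In a set of at least three applicants each one has exactly two neighbours. -/
lemma card_filter_adj {n : ℕ} {P : Finset (Fin n)} {z : Fin n} (hz : z ∈ P) (hP : 3 ≤ P.card) :
    (P.filter fun y => Adj P y z).card = 2 := by
  have himg : (P.filter fun y => Adj P y z).image (rr P) =
      (Finset.Icc 1 (P.card : ℤ)).filter fun t => t - rr P z ∈ Δ P.card ∨ rr P z - t ∈ Δ P.card := by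
    rw [← image_rr, Finset.filter_image]
    congr 1
    apply Finset.filter_congr
    intro y hy
    simp [Adj, hy, hz]
  rw [← Finset.card_image_of_injOn ((rr_injOn P).mono (by
    exact_mod_cast Finset.filter_subset _ _)), himg]
  have hrz : rr P z ∈ Finset.Icc 1 (P.card : ℤ) := image_rr P ▸ Finset.mem_image_of_mem _ hz
  generalize rr P z = a at *
  generalize P.card = m at *
  rw [Finset.mem_Icc] at hrz
  have hm : (3 : ℤ) ≤ m := by exact_mod_cast hP
  rw [Finset.card_eq_two]
  refine ⟨if a = 1 then m else a - 1, if a = m then 1 else a + 1, ?_, ?_⟩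
  · split_ifs <;> omega
  · ext t
    simp only [Δ, Finset.mem_filter, Finset.mem_Icc, Finset.mem_insert, Finset.mem_singleton]
    split_ifs <;> omega

/-- Double counting over the position whose applicant is swapped into position `p`. -/
lemma card_filter_mul_card_of_swap {ι α : Type*} [DecidableEq ι]
    (S : Finset (ι → α)) (J : Finset ι) (p : ι) (Q : (ι → α) → α → Prop)
    [∀ x v, Decidable (Q x v)] (c : ℕ)
    (hS : ∀ j ∈ J, ∀ x ∈ S, x ∘ Equiv.swap j p ∈ S)
    (hQ : ∀ j ∈ J, ∀ x ∈ S, ∀ v, Q (x ∘ Equiv.swap j p) v ↔ Q x v)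
    (hc : ∀ x ∈ S, (J.filter fun j => Q x (x j)).card = c) :
    (S.filter fun x => Q x (x p)).card * J.card = S.card * c := by
  have hj : ∀ j ∈ J, (S.filter fun x => Q x (x j)).card = (S.filter fun x => Q x (x p)).card := by
    intro j hj
    apply Finset.card_nbij' (fun x => x ∘ Equiv.swap j p) (fun x => x ∘ Equiv.swap j p)
    · intro x hx
      simp only [Finset.coe_filter, Set.mem_ofPred_eq] at hx ⊢
      refine ⟨hS j hj x hx.1, (hQ j hj x hx.1 _).2 ?_⟩
      simpa using hx.2
    · intro x hx
      simp only [Finset.coe_filter, Set.mem_ofPred_eq] at hx ⊢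
      refine ⟨hS j hj x hx.1, (hQ j hj x hx.1 _).2 ?_⟩
      simpa using hx.2
    · intro x _
      ext i
      simp
    · intro x _
      ext i
      simp
  have h := Finset.sum_card_bipartiteAbove_eq_sum_card_bipartiteBelow (s := S) (t := J)
    (fun x j => Q x (x j))
  simp only [Finset.bipartiteAbove, Finset.bipartiteBelow] at h
  rw [Finset.sum_congr rfl hc, Finset.sum_congr rfl hj] at h
  simp only [Finset.sum_const, smul_eq_mul] at h
  rw [h, mul_comm]

lemma card_Ω (n : ℕ) : (Ω n).card = n.factorial := by
  have h : Ω n = Finset.univ.image fun e : Equiv.Perm (Fin n) => (e : Fin n → Fin n) := by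
    ext x
    simp only [Ω, Finset.mem_filter, Finset.mem_univ, true_and, Finset.mem_image]
    constructor
    · intro hx
      exact ⟨Equiv.ofBijective x (Finite.injective_iff_bijective.1 hx), rfl⟩
    · rintro ⟨e, rfl⟩
      exact e.injective
  rw [h, Finset.card_image_of_injective _ Equiv.coe_fn_injective, Finset.card_univ,
    Fintype.card_perm, Fintype.card_fin]

lemma comp_swap_mem_Ω {n : ℕ} {x : Fin n → Fin n} (hx : x ∈ Ω n) (i j : Fin n) :
    x ∘ Equiv.swap i j ∈ Ω n := by
  simp only [Ω, Finset.mem_filter, Finset.mem_univ, true_and] at hx ⊢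
  exact hx.comp (Equiv.injective _)

lemma get_eq {n : ℕ} [NeZero n] (x : Fin n → Fin n) {i : ℕ} (hi : i - 1 < n) :
    get x i = x ⟨i - 1, hi⟩ := by
  unfold get
  congr 2
  exact Nat.mod_eq_of_lt hi

lemma get_comp_swap {n : ℕ} [NeZero n] (x : Fin n → Fin n) {i : ℕ} (hi : i - 1 < n) {a b : Fin n}
    (ha : (a : ℕ) < i - 1) (hb : (b : ℕ) < i - 1) : get (x ∘ Equiv.swap a b) i = get x i := by
  rw [get_eq _ hi, get_eq _ hi, Function.comp_apply, Equiv.swap_apply_of_ne_of_ne]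
  · exact Fin.ne_of_gt ha
  · exact Fin.ne_of_gt hb

lemma mem_pre {n : ℕ} {x : Fin n → Fin n} {i : ℕ} {y : Fin n} :
    y ∈ pre x i ↔ ∃ j : Fin n, (j : ℕ) < i ∧ x j = y := by
  simp [pre]

lemma pre_comp_swap {n : ℕ} (x : Fin n → Fin n) {i : ℕ} {a b : Fin n}
    (ha : (a : ℕ) < i) (hb : (b : ℕ) < i) : pre (x ∘ Equiv.swap a b) i = pre x i := by
  unfold pre
  rw [← Finset.image_image]
  congr 1
  ext j
  simp only [Finset.mem_image, Finset.mem_filter, Finset.mem_univ, true_and]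
  have key : ∀ l : Fin n, (l : ℕ) < i → ((Equiv.swap a b l : Fin n) : ℕ) < i := by
    intro l hl
    rw [Equiv.swap_apply_def]
    split_ifs <;> assumption
  constructor
  · rintro ⟨l, hl, rfl⟩
    exact key l hl
  · intro hj
    exact ⟨Equiv.swap a b j, key j hj, by simp⟩

lemma card_filter_val_lt {n i : ℕ} (hi : i ≤ n) :
    (Finset.univ.filter fun j : Fin n => (j : ℕ) < i).card = i := by
  rw [Fin.card_filter_val_lt, min_eq_right hi]

lemma card_pre {n : ℕ} {x : Fin n → Fin n} (hx : Function.Injective x) {i : ℕ} (hi : i ≤ n) :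
    (pre x i).card = i := by
  rw [pre, Finset.card_image_of_injective _ hx, card_filter_val_lt hi]

/-- The recursion in `r`: the applicant at position `r - 1` is one of `r - 1` equally likely
ones, of which `r - 3` are not adjacent to the applicant at position `r`. -/
lemma card_Lam_mul {m r k : ℕ} (hr : 3 ≤ r) (hrk : r ≤ k) (hk : k ≤ m) :
    (Lam (m + 1) r k).card * (r - 1) = (Lam (m + 1) (r + 1) k).card * (r - 3) := by
  set J : Finset (Fin (m + 1)) := Finset.univ.filter fun j => (j : ℕ) < r - 1 with hJ
  let p : Fin (m + 1) := ⟨r - 2, by omega⟩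
  have hJc : J.card = r - 1 := card_filter_val_lt (by omega)
  have hLam : Lam (m + 1) r k = (Lam (m + 1) (r + 1) k).filter fun x =>
      ¬ Adj (pre x r) (x p) (get x r) := by
    ext x
    have hp : get x (r - 1) = x p := get_eq x (by omega)
    simp only [Lam, Finset.mem_filter, ← hp]
    constructor
    · rintro ⟨h1, h2, h3⟩
      exact ⟨⟨h1, h2, fun i hi hri => h3 i hi (by omega)⟩, h3 r hrk le_rfl⟩
    · rintro ⟨⟨h1, h2, h3⟩, h4⟩
      refine ⟨h1, h2, fun i hi hri => ?_⟩
      rcases hri.eq_or_lt with rfl | h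
      · exact h4
      · exact h3 i hi h
  rw [hLam, ← hJc]
  apply card_filter_mul_card_of_swap _ _ _ fun x v => ¬ Adj (pre x r) v (get x r)
  · intro j hj x hx
    have hj' : (j : ℕ) < r - 1 := by simpa [hJ] using hj
    have hp' : (p : ℕ) < r - 1 := by simp only [p]; omega
    simp only [Lam, Finset.mem_filter] at hx ⊢
    obtain ⟨h1, h2, h3⟩ := hx
    refine ⟨comp_swap_mem_Ω h1 _ _, ?_, fun i hi hri => ?_⟩
    · rwa [get_comp_swap, get_comp_swap] <;> omega
    · rw [get_comp_swap, get_comp_swap, pre_comp_swap]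
      · exact h3 i hi hri
      all_goals omega
  · intro j hj x hx v
    have hj' : (j : ℕ) < r - 1 := by simpa [hJ] using hj
    have hp' : (p : ℕ) < r - 1 := by simp only [p]; omega
    rw [get_comp_swap x (by omega) hj' hp', pre_comp_swap x (by omega) (by omega)]
  · intro x hx
    have hinj : Function.Injective x := by
      simp only [Lam, Ω, Finset.mem_filter, Finset.mem_univ, true_and] at hx
      exact hx.1
    let q : Fin (m + 1) := ⟨r - 1, by omega⟩
    have hq : get x r = x q := get_eq x (by omega)
    have hmem : get x r ∈ pre x r := by
      rw [hq, mem_pre]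
      exact ⟨q, by simp only [q]; omega, rfl⟩
    have hcard : (pre x r).card = r := card_pre hinj (by omega)
    have h2 := card_filter_adj hmem (by omega)
    have himg : (J.filter fun j => Adj (pre x r) (x j) (get x r)).image x =
        (pre x r).filter fun y => Adj (pre x r) y (get x r) := by
      ext y
      simp only [Finset.mem_image, Finset.mem_filter, hJ, Finset.mem_univ, true_and, mem_pre]
      constructor
      · rintro ⟨j, ⟨h, h'⟩, rfl⟩
        exact ⟨⟨j, by omega, rfl⟩, h'⟩
      · rintro ⟨⟨j, h, rfl⟩, h'⟩
        refine ⟨j, ⟨?_, h'⟩, rfl⟩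
        by_contra hcon
        have hjq : j = q := Fin.ext (by simp only [q]; omega)
        have hself := h'.2.2
        change _ ∈ Δ (pre x r).card ∨ _ ∈ Δ (pre x r).card at hself
        rw [hjq, ← hq, hcard] at hself
        simp only [Δ, sub_self, Finset.mem_insert, Finset.mem_singleton] at hself
        omega
    rw [← himg, Finset.card_image_of_injective _ hinj] at h2
    have := Finset.card_filter_add_card_filter_not (s := J)
      (fun j => Adj (pre x r) (x j) (get x r))
    omega

lemma card_Lam_succ_self {m k : ℕ} (hm : 2 ≤ m) (hk1 : 1 ≤ k) (hk : k ≤ m) :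
    (Lam (m + 1) (k + 1) k).card = 2 * (m + 1) * (m - 1).factorial := by
  let p : Fin (m + 1) := ⟨k, by omega⟩
  let q : Fin (m + 1) := ⟨k - 1, by omega⟩
  have hpq : p ≠ q := Fin.ne_of_val_ne (by simp only [p, q]; omega)
  have hLam : Lam (m + 1) (k + 1) k = (Ω (m + 1)).filter fun x =>
      Adj Finset.univ (x p) (x q) := by
    ext x
    have hp : get x (k + 1) = x p := get_eq x (by omega)
    have hq : get x k = x q := get_eq x (by omega)
    simp only [Lam, Finset.mem_filter, hp, hq]
    rw [adj_comm]
    constructor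
    · rintro ⟨h1, h2, -⟩
      exact ⟨h1, h2⟩
    · rintro ⟨h1, h2⟩
      exact ⟨h1, h2, fun i _ _ => by omega⟩
  have h := card_filter_mul_card_of_swap (Ω (m + 1)) (Finset.univ.erase q) p
    (fun x v => Adj Finset.univ v (x q)) 2 (fun j _ x hx => comp_swap_mem_Ω hx _ _)
    (by
      intro j hj x _ v
      rw [Function.comp_apply, Equiv.swap_apply_of_ne_of_ne (Finset.ne_of_mem_erase hj).symm
        hpq.symm])
    (by
      intro x hx
      have hinj : Function.Injective x := by simpa [Ω] using hx
      have hsurj := Finite.surjective_of_injective hinj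
      have hc : 3 ≤ (Finset.univ : Finset (Fin (m + 1))).card := by simp; omega
      rw [← card_filter_adj (Finset.mem_univ (x q)) hc, ← Finset.card_image_of_injective _ hinj]
      congr 1
      ext y
      obtain ⟨j, rfl⟩ := hsurj y
      simp only [Finset.mem_image, Finset.mem_filter, Finset.mem_erase, Finset.mem_univ, true_and,
        and_true, hinj.eq_iff, exists_eq_right, and_iff_right_iff_imp]
      rintro h rfl
      have hself := h.2.2
      simp only [Δ, sub_self, Finset.mem_insert, Finset.mem_singleton] at hself
      omega)
  rw [← hLam, card_Ω, Finset.card_erase_of_mem (Finset.mem_univ _), Finset.card_univ,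
    Fintype.card_fin, Nat.add_sub_cancel] at h
  obtain ⟨l, rfl⟩ : ∃ l, m = l + 1 := ⟨m - 1, by omega⟩
  rw [Nat.factorial_succ, Nat.factorial_succ] at h
  apply Nat.eq_of_mul_eq_mul_right (Nat.succ_pos l)
  simp only [Nat.add_sub_cancel]
  rw [h]
  simp only [Nat.succ_eq_add_one]
  ring

lemma mul_card_Lam {m k r : ℕ} (hr : 3 ≤ r) (hrk : r ≤ k + 1) (hk : k ≤ m) :
    (k - 1) * (k - 2) * (Lam (m + 1) r k).card =
      (Lam (m + 1) (k + 1) k).card * ((r - 2) * (r - 3)) := by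
  induction hrk using Nat.decreasingInduction with
  | self =>
    rw [show k + 1 - 2 = k - 1 by omega, show k + 1 - 3 = k - 2 by omega, mul_comm]
  | of_succ r hrk ih =>
    have ih := ih (by omega)
    have h := card_Lam_mul hr (by omega) hk
    apply Nat.eq_of_mul_eq_mul_right (show 0 < r - 1 by omega)
    rw [mul_assoc, h, ← mul_assoc, ih, show r + 1 - 2 = r - 1 by omega,
      show r + 1 - 3 = r - 2 by omega]
    ring

/-- if `r,k ∈ {3,…,n-1}` with `r ≤ k`, then
`(k-1)(k-2) · |Λ_n(r,k)| = 2n(n-2)! · (r-2)(r-3)`. -/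
theorem statement5 {n : ℕ} (hn : 3 < n) (r k : ℕ)
    (hr : 3 ≤ r) (hrk : r ≤ k) (hk : k ≤ n - 1) :
    (k - 1) * (k - 2) * (Lam n r k).card =
      2 * n * Nat.factorial (n - 2) * ((r - 2) * (r - 3)) := by
  obtain ⟨m, rfl⟩ : ∃ m, n = m + 1 := ⟨n - 1, by omega⟩
  rw [mul_card_Lam hr (by omega) (by omega), card_Lam_succ_self (by omega) (by omega) (by omega)]
  rfl
end Secretary
end

section
/- If r ∈ {3,…,n-1} and k, k̄ ∈ {r,…,n-1} with k ≠ k̄, then Λ_n(r,k) ∩ Λ_n(r,k̄) = ∅; consequently, for every x ∈ Λ_n(r) there is exactly one k ∈ {r,…,n-1} with x ∈ Λ_n(r,k). -/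
open Finset

namespace Secretary

theorem Adj.symm {n : ℕ} {P : Finset (Fin n)} {x y : Fin n} (h : Adj P x y) : Adj P y x :=
  ⟨h.2.1, h.1, h.2.2.symm⟩

theorem rr_univ {n : ℕ} (x : Fin n) : rr Finset.univ x = (x : ℤ) + 1 := by
  have h : (Finset.univ.filter fun z => z ≤ x) = Finset.Iic x := by ext; simp
  simp [rr, h]

theorem rr_of_val_eq_succ {n : ℕ} {P : Finset (Fin n)} {x y : Fin n} (hy : y ∈ P)
    (h : (y : ℕ) = x + 1) : rr P y = rr P x + 1 := by
  have hs : (P.filter fun z => z ≤ y) = insert y (P.filter fun z => z ≤ x) := by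
    ext z
    simp only [Finset.mem_filter, Finset.mem_insert, Fin.le_def, Fin.ext_iff]
    constructor
    · rintro ⟨hz, hzy⟩
      by_cases hzx : (z : ℕ) ≤ x
      · exact Or.inr ⟨hz, hzx⟩
      · left; omega
    · rintro (hz | ⟨hz, hzx⟩)
      · exact ⟨(Fin.ext hz : z = y) ▸ hy, hz.le⟩
      · exact ⟨hz, by omega⟩
  have hn : y ∉ P.filter fun z => z ≤ x := by
    simp only [Finset.mem_filter, Fin.le_def]; omega
  simp [rr, hs, Finset.card_insert_of_notMem hn]

theorem rr_of_val_eq_zero {n : ℕ} {P : Finset (Fin n)} {x : Fin n} (hx : x ∈ P)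
    (h : (x : ℕ) = 0) : rr P x = 1 := by
  have hs : (P.filter fun z => z ≤ x) = {x} := by
    ext z
    simp only [Finset.mem_filter, Finset.mem_singleton, Fin.le_def, Fin.ext_iff]
    constructor
    · rintro ⟨-, hz⟩; omega
    · intro hz; exact ⟨(Fin.ext hz : z = x) ▸ hx, hz.le⟩
  simp [rr, hs]

theorem rr_of_val_add_one_eq {n : ℕ} {P : Finset (Fin n)} {x : Fin n}
    (h : (x : ℕ) + 1 = n) : rr P x = P.card := by
  have hs : (P.filter fun z => z ≤ x) = P := by
    refine Finset.filter_true_of_mem fun z _ => ?_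
    have := z.isLt
    rw [Fin.le_def]; omega
  simp [rr, hs]

/-- Cyclic adjacency is inherited by subsets containing both elements. -/
theorem Adj.of_univ {n : ℕ} {P : Finset (Fin n)} {x y : Fin n}
    (h : Adj Finset.univ x y) (hx : x ∈ P) (hy : y ∈ P) : Adj P x y := by
  wlog hxy : x ≤ y generalizing x y
  · exact (this h.symm hy hx (le_of_not_ge hxy)).symm
  have hd := h.2.2
  simp only [rr_univ, Δ, Finset.mem_insert, Finset.mem_singleton, Finset.card_univ,
    Fintype.card_fin] at hd
  rw [Fin.le_def] at hxy
  have hlt := y.isLt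
  obtain hs | ⟨h0, h1⟩ : (y : ℕ) = x + 1 ∨ (x : ℕ) = 0 ∧ (y : ℕ) + 1 = n := by omega
  · refine ⟨hx, hy, Or.inr ?_⟩
    simp [Δ, rr_of_val_eq_succ hy hs]
  · refine ⟨hx, hy, Or.inr ?_⟩
    simp [Δ, rr_of_val_eq_zero hx h0, rr_of_val_add_one_eq h1]

theorem get_mem_pre {n : ℕ} [NeZero n] (x : Fin n → Fin n) {i j : ℕ} (hj : j ≠ 0)
    (hji : j ≤ i) : get x j ∈ pre x i := by
  refine Finset.mem_image_of_mem x (Finset.mem_filter.2 ⟨Finset.mem_univ _, ?_⟩)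
  exact (Nat.mod_le _ _).trans_lt (by omega)

theorem notMem_Lam_of_lt {n r k k' : ℕ} (hr : 0 < r) (hrk : r ≤ k) (hkk' : k < k')
    {x : Fin n → Fin n} (hx : x ∈ Lam n r k) : x ∉ Lam n r k' := by
  cases n with
  | zero => simp [Lam] at hx
  | succ m =>
    intro hx'
    refine (Finset.mem_filter.1 hx').2.2 (k + 1) hkk' (by omega) ?_
    exact (Finset.mem_filter.1 hx).2.1.of_univ
      (get_mem_pre x (by omega) (by omega)) (get_mem_pre x (by omega) le_rfl)

/-- the sets `Λ_n(r,k)`, `k ∈ {r,…,n-1}`, are pairwise disjoint;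
consequently every `x ∈ Λ_n(r)` lies in exactly one `Λ_n(r,k)`. -/
theorem statement6 {n : ℕ} (hn : 3 < n) (r : ℕ) (hr1 : 3 ≤ r) (hr2 : r ≤ n - 1) :
    (∀ k k', k ∈ Finset.Icc r (n - 1) → k' ∈ Finset.Icc r (n - 1) → k ≠ k' →
      Lam n r k ∩ Lam n r k' = ∅) ∧
    ∀ x ∈ LamU n r, ∃! k, k ∈ Finset.Icc r (n - 1) ∧ x ∈ Lam n r k := by
  have huniq : ∀ x k k', k ∈ Finset.Icc r (n - 1) → k' ∈ Finset.Icc r (n - 1) →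
      x ∈ Lam n r k → x ∈ Lam n r k' → k = k' := by
    intro x k k' hk hk' hx hx'
    rw [Finset.mem_Icc] at hk hk'
    rcases lt_trichotomy k k' with h | h | h
    · exact absurd hx' (notMem_Lam_of_lt (by omega) hk.1 h hx)
    · exact h
    · exact absurd hx (notMem_Lam_of_lt (by omega) hk'.1 h hx')
  refine ⟨fun k k' hk hk' hne => Finset.eq_empty_of_forall_notMem fun x hx => ?_, fun x hx => ?_⟩
  · rw [Finset.mem_inter] at hx
    exact hne (huniq x k k' hk hk' hx.1 hx.2)
  · obtain ⟨k, hk, hxk⟩ := Finset.mem_biUnion.1 hx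
    exact ⟨k, ⟨hk, hxk⟩, fun k' h => huniq x k' k h.1 hk h.2 hxk⟩
end Secretary
end
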